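/- Let F be a field of characteristic p > 0 and G a finite group whose p-Sylow subgroups are cyclic. Then for every field extension K/F and every finitely generated KG-module M, M descends to an intermediate field F ⊆ K₀ ⊆ K that is algebraic over F; i.e., ed(Mod_{FG}) = 0. -/

import Mathlib

open TensorProduct

/-- `F` is a `C₁`-field. -/
def IsC1Field (F : Type) [Field F] : Prop :=
  ∀ (n d : ℕ) (f : MvPolynomial (Fin n) F), f.IsHomogeneous d → 0 < d → d < n →
    ∃ x : Fin n → F, x ≠ 0 ∧ MvPolynomial.eval x f = 0

/-- `M` descends to the intermediate field `E` of `K/F`. -/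
def DescendsTo (F K A : Type) [Field F] [Field K] [Algebra F K]
    [Ring A] [Algebra F A]
    (M : Type) [AddCommGroup M] [Module F M] [Module K M] [Module A M]
    [IsScalarTower F K M] [IsScalarTower F A M] [SMulCommClass K A M]
    (E : IntermediateField F K) : Prop :=
  ∃ N : Submodule E M, (∀ (a : A) (x : M), x ∈ N → a • x ∈ N) ∧
    IsBaseChange K N.subtype

set_option linter.unusedSectionVars false

/-- in a finite monoid, some positive power of each element is idempotent. -/
theorem exists_pow_idem {A : Type*} [Monoid A] [Finite A] (x : A) :
    ∃ n : ℕ, 0 < n ∧ IsIdempotentElem (x ^ n) := by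
  obtain ⟨a, b, hab, h⟩ := Finite.exists_ne_map_eq_of_infinite (fun n : ℕ => x ^ n)
  wlog hlt : a < b generalizing a b
  · exact this b a hab.symm h.symm (by omega)
  obtain ⟨d, rfl⟩ := Nat.exists_eq_add_of_lt hlt
  replace h : x ^ a = x ^ (a + d + 1) := h
  set e := d + 1 with he
  have h1 : ∀ m, a ≤ m → x ^ (m + e) = x ^ m := by
    intro m hm
    obtain ⟨c, rfl⟩ := Nat.exists_eq_add_of_le hm
    have : x ^ (a + e) = x ^ a := by rw [h]; congr 1
    rw [show a + c + e = (a + e) + c by ring, pow_add, this, ← pow_add]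
  have h2 : ∀ t m, a ≤ m → x ^ (m + t * e) = x ^ m := by
    intro t
    induction t with
    | zero => intro m _; simp
    | succ t ih =>
      intro m hm
      rw [show m + (t + 1) * e = (m + t * e) + e by ring, h1 _ (by omega), ih m hm]
  refine ⟨(a + 1) * e, by positivity, ?_⟩
  unfold IsIdempotentElem
  rw [← pow_add]
  exact h2 _ _ (by nlinarith)

/-- matrices over a locally finite field. -/
theorem exists_finite_subring {k E : Type*} [Field k] [Ring E] [Algebra k E] [Module.Finite k E]
    (hk : ∀ s : Finset k, ∃ k0 : Subring k, Finite k0 ∧ (s : Set k) ⊆ k0) (s : Finset E) :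
    ∃ E0 : Subring E, Finite E0 ∧ (s : Set E) ⊆ E0 := by
  classical
  let b := Module.finBasis k E
  let φ := Algebra.leftMulMatrix b
  have hφ : Function.Injective φ := Algebra.leftMulMatrix_injective b
  obtain ⟨k0, hfin, hs⟩ := hk (s.biUnion fun x => Finset.univ.image fun ij : _ × _ => φ x ij.1 ij.2)
  let R0 : Subring (Matrix _ _ k) := (RingHom.mapMatrix (m := Fin (Module.finrank k E)) k0.subtype).range
  have hR0 : Finite R0 := by
    have : Finite (Matrix (Fin (Module.finrank k E)) (Fin (Module.finrank k E)) k0) :=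
      inferInstanceAs (Finite (Fin (Module.finrank k E) → Fin (Module.finrank k E) → k0))
    exact Finite.of_surjective _ (RingHom.rangeRestrict_surjective
      (RingHom.mapMatrix (m := Fin (Module.finrank k E)) k0.subtype))
  refine ⟨R0.comap φ.toRingHom, ?_, ?_⟩
  · refine Finite.of_injective (fun x : R0.comap φ.toRingHom => (⟨φ x.1, x.2⟩ : R0)) ?_
    intro x y h
    exact Subtype.ext (hφ (congrArg Subtype.val h))
  · intro x hx
    have : ∀ i j, φ x i j ∈ k0 := by
      intro i j
      apply hs
      simp only [Finset.coe_biUnion, Set.mem_iUnion]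
      exact ⟨x, hx, by simpa using ⟨i, j, rfl⟩⟩
    refine ⟨fun i j => ⟨φ x i j, this i j⟩, ?_⟩
    ext i j
    rfl

theorem nil_or_unit {E : Type*} [Ring E]
    (hE : ∀ s : Finset E, ∃ E0 : Subring E, Finite E0 ∧ (s : Set E) ⊆ E0)
    (hid : ∀ e : E, IsIdempotentElem e → e = 0 ∨ e = 1) (x : E) : IsNilpotent x ∨ IsUnit x := by
  obtain ⟨E0, hf, hs⟩ := hE {x}
  obtain ⟨n, hn, h⟩ := exists_pow_idem (⟨x, hs (by simp)⟩ : E0)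
  have h' : IsIdempotentElem (x ^ n) := congrArg Subtype.val h
  rcases hid _ h' with h | h
  · exact Or.inl ⟨n, h⟩
  · exact Or.inr (IsUnit.of_pow_eq_one h hn.ne')

/-- structure of finite rings with trivial idempotents -/
theorem finite_local_gen {A : Type*} [Ring A] [Finite A] [Nontrivial A]
    (hid : ∀ e : A, IsIdempotentElem e → e = 0 ∨ e = 1) :
    ∃ z : A, ∃ n : ℕ, (Ring.jacobson A) ^ n = ⊥ ∧
      ∀ x : A, x ∈ Ring.jacobson A ∨ ∃ i : ℕ, x - z ^ i ∈ Ring.jacobson A := by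
  have hnu : ∀ x : A, IsNilpotent x ∨ IsUnit x :=
    nil_or_unit (fun s => ⟨⊤, inferInstance, by simp⟩) hid
  have hJ : ∀ x : A, IsNilpotent x → x ∈ Ring.jacobson A := by
    intro x hx
    rw [← Ideal.jacobson_bot, Ideal.mem_jacobson_iff]
    intro y
    have hyx : IsNilpotent (y * x) := by
      rcases hnu (y * x) with h | h
      · exact h
      · exfalso
        obtain ⟨u, hu⟩ := h
        have hl : ∀ n, x ^ n = 0 → False := by
          intro n
          induction n with
          | zero => simp
          | succ n ih =>
            intro h0
            apply ih
            have h1 : (u : A) * x ^ n = 0 := by rw [hu, mul_assoc, ← pow_succ', h0, mul_zero]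
            simpa using h1
        obtain ⟨n, hn⟩ := hx
        exact hl n hn
    obtain ⟨u, hu⟩ := hyx.isUnit_one_add
    refine ⟨(↑u⁻¹ : A), ?_⟩
    have : (↑u⁻¹ : A) * (1 + y * x) = 1 := by rw [← hu]; simp
    simp only [Ideal.mem_bot]
    rw [← this]; noncomm_ring
  have hJ' : ∀ x : A, x ∈ Ring.jacobson A → ¬ IsUnit x := by
    intro x hx hu
    have := Ideal.eq_top_of_isUnit_mem _ hx hu
    exact (Ring.jacobson_lt_top A).ne this
  obtain ⟨n, hn⟩ := IsArtinianRing.isNilpotent_jacobson_bot (R := A)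
  let D := A ⧸ Ring.jacobson A
  have hD0 : ∀ x : A, (Ideal.Quotient.mk (Ring.jacobson A) x) = 0 ↔ x ∈ Ring.jacobson A :=
    fun x => Ideal.Quotient.eq_zero_iff_mem
  have : Nontrivial D := Ideal.Quotient.nontrivial_iff.mpr (Ring.jacobson_lt_top A).ne
  have : Finite D := Finite.of_surjective _ (Ideal.Quotient.mk_surjective (I := Ring.jacobson A))
  have : NoZeroDivisors D := by
    constructor
    intro a b hab
    obtain ⟨a, rfl⟩ := Ideal.Quotient.mk_surjective a
    obtain ⟨b, rfl⟩ := Ideal.Quotient.mk_surjective b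
    rcases hnu a with h | h
    · exact Or.inl ((hD0 _).2 (hJ _ h))
    · right
      exact (h.map (Ideal.Quotient.mk (Ring.jacobson A))).mul_right_eq_zero.mp hab
  have : IsDomain D := NoZeroDivisors.to_isDomain D
  let _ : Field D := (Finite.isDomain_to_isField D).toField
  obtain ⟨g, hg⟩ := IsCyclic.exists_monoid_generator (α := Dˣ)
  obtain ⟨z, hz⟩ := Ideal.Quotient.mk_surjective (I := Ring.jacobson A) (g : D)
  refine ⟨z, n, by simpa [Ideal.jacobson_bot] using hn, ?_⟩
  intro x
  by_cases hx : x ∈ Ring.jacobson A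
  · exact Or.inl hx
  right
  have hx' : (Ideal.Quotient.mk (Ring.jacobson A) x : D) ≠ 0 := fun h => hx ((hD0 _).1 h)
  obtain ⟨i, hi⟩ := hg (Units.mk0 _ hx')
  refine ⟨i, ?_⟩
  rw [← hD0, map_sub, map_pow, hz]
  have := congrArg Units.val hi
  simp only [Units.val_pow_eq_pow_val, Units.val_mk0] at this
  rw [← this]
  exact sub_self _

open Polynomial in
theorem irreducible_map_of_closed {k K : Type*} [Field k] [Field K] [Algebra k K]
    (hcl : ∀ x : K, IsIntegral k x → x ∈ (algebraMap k K).range) (f : k[X]) (hm : f.Monic)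
    (hf : Irreducible f) : Irreducible (f.map (algebraMap k K)) := by
  have key : ∀ g : K[X], g.Monic → g ∣ f.map (algebraMap k K) →
      ∃ g0 : k[X], g0.map (algebraMap k K) = g := by
    intro g hg hd
    have h1 := integralClosure.mem_lifts_of_monic_of_dvd_map K hm hg hd
    have h2 : g ∈ lifts (algebraMap k K) := by
      rw [lifts_iff_coeff_lifts] at h1 ⊢
      intro n
      obtain ⟨y, hy⟩ := h1 n
      obtain ⟨c, hc⟩ := hcl (g.coeff n) (hy ▸ y.2)
      exact ⟨c, hc⟩
    exact (mem_lifts g).1 h2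
  have hinj : Function.Injective (Polynomial.map (algebraMap k K)) :=
    Polynomial.map_injective _ (algebraMap k K).injective
  rw [(hm.map _).irreducible_iff_natDegree]
  rw [hm.irreducible_iff_natDegree] at hf
  refine ⟨fun h => hf.1 (hinj (by simpa using h)), ?_⟩
  intro g h hg hh hgh
  obtain ⟨g0, rfl⟩ := key g hg ⟨h, hgh.symm⟩
  obtain ⟨h0, rfl⟩ := key h hh ⟨_, by rw [mul_comm]; exact hgh.symm⟩
  rw [natDegree_map, natDegree_map]
  refine hf.2 g0 h0 ?_ ?_ ?_
  · exact monic_of_injective (algebraMap k K).injective hg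
  · exact monic_of_injective (algebraMap k K).injective hh
  · exact hinj (by simpa using hgh)

open Polynomial in
theorem exists_irreducible_nonunit {k E : Type*} [Field k] [Ring E] [Nontrivial E] [Algebra k E]
    [Module.Finite k E] (z : E) :
    ∃ f : k[X], f.Monic ∧ Irreducible f ∧ ¬ IsUnit (aeval z f) := by
  have key : ∀ m : k[X], m ≠ 0 → ¬ IsUnit (aeval z m) →
      ∃ f : k[X], Irreducible f ∧ ¬ IsUnit (aeval z f) := by
    intro m
    induction m using WfDvdMonoid.induction_on_irreducible with
    | zero => intro h; exact absurd rfl h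
    | unit u hu => intro _ h; exact absurd (hu.map (aeval z)) h
    | mul a i ha hi ih =>
      intro h0 h
      by_cases hz : IsUnit (aeval z i)
      · refine ih (right_ne_zero_of_mul h0) fun h' => h ?_
        rw [map_mul]; exact hz.mul h'
      · exact ⟨i, hi, hz⟩
  have hint : IsIntegral k z := Algebra.IsIntegral.isIntegral z
  obtain ⟨f, hf, hz⟩ := key (minpoly k z) (minpoly.ne_zero hint) (by simp)
  have hlc : f.leadingCoeff ≠ 0 := by simpa using hf.ne_zero
  have hunit : IsUnit (C f.leadingCoeff⁻¹) := by simpa using hf.ne_zero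
  refine ⟨f * C f.leadingCoeff⁻¹, monic_mul_leadingCoeff_inv hf.ne_zero, ?_, ?_⟩
  · exact (irreducible_mul_isUnit hunit).2 hf
  · intro h
    apply hz
    rw [map_mul] at h
    have := h.mul ((isUnit_iff_ne_zero.2 hlc).map (algebraMap k E))
    rwa [aeval_C, mul_assoc, ← map_mul, inv_mul_cancel₀ hlc, map_one, mul_one] at this

open Polynomial Pointwise in
theorem isLocalRing_of_span {k K E B : Type*} [Field k] [Field K] [Algebra k K]
    (hk : ∀ s : Finset k, ∃ k0 : Subring k, Finite k0 ∧ (s : Set k) ⊆ k0)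
    (hcl : ∀ x : K, IsIntegral k x → x ∈ (algebraMap k K).range)
    [Ring E] [Algebra k E] [Module.Finite k E] [Nontrivial E]
    (hid : ∀ e : E, IsIdempotentElem e → e = 0 ∨ e = 1)
    [Ring B] [Nontrivial B] [Algebra K B] (j : E →+* B)
    (hj : ∀ (c : k) (x : E), j (c • x) = algebraMap k K c • j x)
    (hspan : Submodule.span K (Set.range j) = ⊤) : IsLocalRing B := by
  classical
  have hE := exists_finite_subring (E := E) hk
  have hnu := nil_or_unit hE hid
  let b := Module.finBasis k E
  obtain ⟨E0, hfin, hE0⟩ := hE (Finset.univ.image b)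
  have hid0 : ∀ e : E0, IsIdempotentElem e → e = 0 ∨ e = 1 := by
    intro e he
    rcases hid e (congrArg Subtype.val he) with h | h
    · exact Or.inl (Subtype.ext h)
    · exact Or.inr (Subtype.ext h)
  obtain ⟨z, n, hn, hz⟩ := finite_local_gen hid0
  let i : E0 →+* B := j.comp E0.subtype
  -- `B` is spanned by the image of `E0`
  have hspan0 : Submodule.span K (Set.range i) = ⊤ := by
    rw [eq_top_iff, ← hspan, Submodule.span_le]
    rintro _ ⟨x, rfl⟩
    rw [← b.sum_repr x, map_sum]
    refine Submodule.sum_mem _ fun l _ => ?_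
    rw [hj]
    exact Submodule.smul_mem _ _ (Submodule.subset_span ⟨⟨b l, hE0 (by simp)⟩, rfl⟩)
  -- the nilpotent ideal
  let J : Submodule K B := Submodule.span K (i '' (Ring.jacobson E0 : Set E0))
  have hJl : ∀ x ν : B, ν ∈ J → x * ν ∈ J := by
    intro x ν hν
    have hx : x ∈ Submodule.span K (Set.range i) := hspan0 ▸ Submodule.mem_top
    induction hx using Submodule.span_induction with
    | zero => simp
    | add x y _ _ hx hy => rw [add_mul]; exact J.add_mem hx hy
    | smul c x _ hx => rw [smul_mul_assoc]; exact J.smul_mem _ hx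
    | mem x hx =>
      obtain ⟨x, rfl⟩ := hx
      induction hν using Submodule.span_induction with
      | zero => simp
      | add y y' _ _ hx hy => rw [mul_add]; exact J.add_mem hx hy
      | smul c y _ hx => rw [mul_smul_comm]; exact J.smul_mem _ hx
      | mem y hy =>
        obtain ⟨y, hy, rfl⟩ := hy
        exact Submodule.subset_span ⟨x * y, Ideal.mul_mem_left _ _ hy, map_mul _ _ _⟩
  have hJr : ∀ x ν : B, ν ∈ J → ν * x ∈ J := by
    intro x ν hν
    have hx : x ∈ Submodule.span K (Set.range i) := hspan0 ▸ Submodule.mem_top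
    induction hx using Submodule.span_induction with
    | zero => simp
    | add x y _ _ hx hy => rw [mul_add]; exact J.add_mem hx hy
    | smul c x _ hx => rw [mul_smul_comm]; exact J.smul_mem _ hx
    | mem x hx =>
      obtain ⟨x, rfl⟩ := hx
      induction hν using Submodule.span_induction with
      | zero => simp
      | add y y' _ _ hx hy => rw [add_mul]; exact J.add_mem hx hy
      | smul c y _ hx => rw [smul_mul_assoc]; exact J.smul_mem _ hx
      | mem y hy =>
        obtain ⟨y, hy, rfl⟩ := hy
        exact Submodule.subset_span ⟨y * x, Ideal.mul_mem_right _ _ hy, map_mul _ _ _⟩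
  have hJn : J ^ n = ⊥ := by
    have h1 : ∀ m, (i '' (Ring.jacobson E0 : Set E0)) ^ m ⊆
        i '' ((Ring.jacobson E0 ^ m : Ideal E0) : Set E0) := by
      intro m
      induction m with
      | zero =>
        intro x hx
        rw [pow_zero, Set.mem_one] at hx
        subst hx
        refine ⟨1, ?_, map_one _⟩
        rw [Submodule.pow_zero, Ideal.one_eq_top]
        trivial
      | succ m ih =>
        rw [pow_succ]
        rintro _ ⟨x, hx, y, hy, rfl⟩
        obtain ⟨x, hx2, rfl⟩ := ih hx
        obtain ⟨y, hy, rfl⟩ := hy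
        refine ⟨x * y, ?_, map_mul _ _ _⟩
        rw [Submodule.pow_succ]
        exact Ideal.mul_mem_mul hx2 hy
    rw [Submodule.span_pow, eq_bot_iff, Submodule.span_le]
    intro x hx
    obtain ⟨y, hy, rfl⟩ := h1 n hx
    rw [hn] at hy
    have : y = 0 := by simpa using hy
    simp [this]
  have hJnil : ∀ ν ∈ J, IsNilpotent ν := by
    intro ν hν
    refine ⟨n, ?_⟩
    have := Submodule.pow_mem_pow J hν n
    rw [hJn] at this
    simpa using this
  have hnilJ : ∀ c ν : B, IsNilpotent c → ν ∈ J → IsNilpotent (c + ν) := by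
    rintro c ν ⟨m, hm⟩ hν
    have h1 : ∀ m, (c + ν) ^ m - c ^ m ∈ J := by
      intro m
      induction m with
      | zero => simp
      | succ m ih =>
        have : (c + ν) ^ (m + 1) - c ^ (m + 1) = ((c + ν) ^ m - c ^ m) * c + (c + ν) ^ m * ν := by
          rw [pow_succ, pow_succ]; noncomm_ring
        rw [this]
        exact J.add_mem (hJr _ _ ih) (hJl _ _ hν)
    have h2 := h1 m
    rw [hm, sub_zero] at h2
    obtain ⟨l, hl⟩ := hJnil _ h2
    exact ⟨m * l, by rw [pow_mul, hl]⟩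
  have hunitJ : ∀ c ν : B, IsUnit c → ν ∈ J → IsUnit (c + ν) := by
    rintro _ ν ⟨u, rfl⟩ hν
    have h1 : (u : B) + ν = u * (1 + ↑u⁻¹ * ν) := by rw [mul_add, ← mul_assoc]; simp
    rw [h1]
    exact u.isUnit.mul (hJnil _ (hJl _ _ hν)).isUnit_one_add
  -- decomposition
  have hdec : ∀ φ : B, ∃ (q : K[X]) (ν : B), ν ∈ J ∧ φ = aeval (i z) q + ν := by
    intro φ
    have hx : φ ∈ Submodule.span K (Set.range i) := hspan0 ▸ Submodule.mem_top
    induction hx using Submodule.span_induction with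
    | zero => exact ⟨0, 0, J.zero_mem, by simp⟩
    | add x y _ _ hx hy =>
      obtain ⟨q, ν, hν, rfl⟩ := hx
      obtain ⟨q', ν', hν', rfl⟩ := hy
      exact ⟨q + q', ν + ν', J.add_mem hν hν', by rw [map_add]; abel⟩
    | smul c x _ hx =>
      obtain ⟨q, ν, hν, rfl⟩ := hx
      exact ⟨c • q, c • ν, J.smul_mem _ hν, by rw [map_smul, smul_add]⟩
    | mem x hx =>
      obtain ⟨x, rfl⟩ := hx
      rcases hz x with h | ⟨l, h⟩
      · exact ⟨0, i x, Submodule.subset_span ⟨x, h, rfl⟩, by simp⟩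
      · exact ⟨X ^ l, i (x - z ^ l), Submodule.subset_span ⟨_, h, rfl⟩, by simp⟩
  -- irreducible polynomial
  obtain ⟨f, hfm, hfi, hfz⟩ := exists_irreducible_nonunit (k := k) (z : E)
  have hfnil : IsNilpotent (aeval (i z) (f.map (algebraMap k K))) := by
    have h1 : aeval (i z) (f.map (algebraMap k K)) = j (aeval (z : E) f) := by
      rw [aeval_eq_sum_range, aeval_eq_sum_range, map_sum, natDegree_map]
      refine Finset.sum_congr rfl fun l _ => ?_
      rw [hj, coeff_map, map_pow]
      rfl
    rw [h1]
    exact ((hnu _).resolve_right hfz).map j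
  have hfK := irreducible_map_of_closed hcl f hfm hfi
  refine IsLocalRing.of_isUnit_or_isUnit_one_sub_self fun φ => ?_
  obtain ⟨q, ν, hν, rfl⟩ := hdec φ
  by_cases hd : f.map (algebraMap k K) ∣ q
  · right
    obtain ⟨r, rfl⟩ := hd
    apply IsNilpotent.isUnit_one_sub
    refine hnilJ _ _ ?_ hν
    rw [map_mul]
    exact Commute.isNilpotent_mul_right (by
      unfold Commute SemiconjBy
      rw [← map_mul, ← map_mul, mul_comm]) hfnil
  · left
    refine hunitJ _ _ ?_ hν
    obtain ⟨a, c, hac⟩ := (hfK.coprime_iff_not_dvd.2 hd)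
    have h1 : aeval (i z) c * aeval (i z) q = 1 - aeval (i z) a * aeval (i z) (f.map (algebraMap k K)) := by
      rw [eq_sub_iff_add_eq, ← map_mul, ← map_mul, ← map_add, add_comm, hac, map_one]
    have h2 : IsUnit (aeval (i z) c * aeval (i z) q) := by
      rw [h1]
      apply IsNilpotent.isUnit_one_sub
      exact Commute.isNilpotent_mul_left (by
        unfold Commute SemiconjBy
        rw [← map_mul, ← map_mul, mul_comm]) hfnil
    have hcomm : Commute (aeval (i z) c) (aeval (i z) q) := by
      unfold Commute SemiconjBy
      rw [← map_mul, ← map_mul, mul_comm]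
    exact (hcomm.isUnit_mul_iff.1 h2).2

theorem ks_aux {R X Y U U' : Type*} [Ring R] [AddCommGroup X] [AddCommGroup Y] [AddCommGroup U]
    [AddCommGroup U'] [Module R X] [Module R Y] [Module R U] [Module R U']
    (e : (X × Y) ≃ₗ[R] (U × U'))
    (hu : IsUnit (((LinearMap.fst R X Y ∘ₗ e.symm.toLinearMap ∘ₗ LinearMap.inl R U U') ∘ₗ
      (LinearMap.fst R U U' ∘ₗ e.toLinearMap ∘ₗ LinearMap.inl R X Y)) : Module.End R X)) :
    ∃ U1 : Submodule R U, Nonempty (U ≃ₗ[R] X × U1) ∧ Nonempty (Y ≃ₗ[R] U1 × U') := by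
  set α : X →ₗ[R] U := LinearMap.fst R U U' ∘ₗ e.toLinearMap ∘ₗ LinearMap.inl R X Y with hα
  set β : U →ₗ[R] X := LinearMap.fst R X Y ∘ₗ e.symm.toLinearMap ∘ₗ LinearMap.inl R U U' with hβ
  obtain ⟨u, hu⟩ := hu
  let v : X →ₗ[R] X := (↑u⁻¹ : Module.End R X)
  have hv1 : ∀ x, v (β (α x)) = x := by
    intro x
    have : (↑u⁻¹ : Module.End R X) * (β ∘ₗ α : Module.End R X) = 1 := by rw [← hu]; simp
    exact LinearMap.congr_fun this x
  have hv2 : ∀ x, β (α (v x)) = x := by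
    intro x
    have : (β ∘ₗ α : Module.End R X) * (↑u⁻¹ : Module.End R X) = 1 := by rw [← hu]; simp
    exact LinearMap.congr_fun this x
  have hβe : ∀ w : U, (e.symm (w, 0)).1 = β w := fun w => rfl
  let s : U →ₗ[R] X := v ∘ₗ β
  have hs : ∀ w, s w = v (β w) := fun w => rfl
  let π : U →ₗ[R] LinearMap.ker s :=
    LinearMap.codRestrict _ (LinearMap.id - α ∘ₗ s) (by
      intro w
      simp [LinearMap.mem_ker, hs, hv1])
  have hπ : ∀ w, (π w : U) = w - α (s w) := fun w => rfl
  refine ⟨LinearMap.ker s, ⟨?_⟩, ⟨?_⟩⟩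
  · refine LinearEquiv.ofBijective (s.prod π) ⟨?_, ?_⟩
    · rw [← LinearMap.ker_eq_bot, LinearMap.ker_eq_bot']
      intro w hw
      have h1 : s w = 0 := congrArg Prod.fst hw
      have h2 : (π w : U) = 0 := congrArg (fun t => (t.2 : U)) hw
      rw [hπ, h1] at h2
      simpa using h2
    · rintro ⟨x, w, hw⟩
      have hw' : s w = 0 := hw
      have h1 : s (α x + w) = x := by rw [map_add, hw', hs, hv1, add_zero]
      refine ⟨α x + w, Prod.ext h1 (Subtype.ext ?_)⟩
      change (π (α x + w) : U) = w
      rw [hπ, h1]; simp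
  · refine LinearEquiv.ofBijective
      ((π.prodMap LinearMap.id) ∘ₗ e.toLinearMap ∘ₗ LinearMap.inr R X Y) ⟨?_, ?_⟩
    · rw [← LinearMap.ker_eq_bot, LinearMap.ker_eq_bot']
      intro y hy
      have h1 : (π (e (0, y)).1 : U) = 0 := congrArg (fun t => (t.1 : U)) hy
      have h2 : (e (0, y)).2 = 0 := congrArg Prod.snd hy
      have h3 : e (0, y) = ((e (0, y)).1, 0) := Prod.ext rfl h2
      have h4 : β (e (0, y)).1 = 0 := by
        rw [← hβe, ← h3, e.symm_apply_apply]
      rw [hπ, hs, h4, map_zero, map_zero, sub_zero] at h1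
      rw [h1] at h3
      have h5 : ((0 : X), y) = 0 := e.injective (by rw [h3]; exact (map_zero e).symm)
      exact congrArg Prod.snd h5
    · rintro ⟨⟨w, hw⟩, w'⟩
      have hw' : s w = 0 := hw
      let x := (e.symm (w, w')).1
      let w2 := w - α (v x)
      have h1 : (e.symm (w2, w')).1 = 0 := by
        have : (w2, w') = (w, w') - (α (v x), 0) := by simp [w2]
        rw [this, map_sub, Prod.fst_sub, hβe, hv2]
        exact sub_self _
      refine ⟨(e.symm (w2, w')).2, ?_⟩
      have h2 : e (0, (e.symm (w2, w')).2) = (w2, w') := by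
        rw [← h1]; exact e.apply_symm_apply _
      change (π (e (0, (e.symm (w2, w')).2)).1, (e (0, (e.symm (w2, w')).2)).2) = _
      rw [h2]
      refine Prod.ext (Subtype.ext ?_) rfl
      change (π w2 : U) = w
      rw [hπ]
      have : s w2 = - v x := by
        simp only [w2]
        rw [map_sub, hw', hs, hv1, zero_sub]
      rw [this]; simp [w2]

theorem ks_step {R X Y U U' : Type*} [Ring R] [AddCommGroup X] [AddCommGroup Y] [AddCommGroup U]
    [AddCommGroup U'] [Module R X] [Module R Y] [Module R U] [Module R U']
    (e : (X × Y) ≃ₗ[R] (U × U')) [IsLocalRing (Module.End R X)] :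
    (∃ U1 : Submodule R U, Nonempty (U ≃ₗ[R] X × U1) ∧ Nonempty (Y ≃ₗ[R] U1 × U')) ∨
    (∃ U1 : Submodule R U', Nonempty (U' ≃ₗ[R] X × U1) ∧ Nonempty (Y ≃ₗ[R] U1 × U)) := by
  let e' : (X × Y) ≃ₗ[R] (U' × U) := e.trans (LinearEquiv.prodComm R U U')
  have key := IsLocalRing.isUnit_or_isUnit_of_add_one (R := Module.End R X)
    (a := (LinearMap.fst R X Y ∘ₗ e.symm.toLinearMap ∘ₗ LinearMap.inl R U U') ∘ₗ
      (LinearMap.fst R U U' ∘ₗ e.toLinearMap ∘ₗ LinearMap.inl R X Y))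
    (b := (LinearMap.fst R X Y ∘ₗ e'.symm.toLinearMap ∘ₗ LinearMap.inl R U' U) ∘ₗ
      (LinearMap.fst R U' U ∘ₗ e'.toLinearMap ∘ₗ LinearMap.inl R X Y)) (by
      ext x
      change (e.symm ((e (x, 0)).1, 0)).1 + (e.symm (0, (e (x, 0)).2)).1 = x
      rw [← Prod.fst_add, ← map_add]
      simp)
  rcases key with h | h
  · exact Or.inl (ks_aux e h)
  · exact Or.inr (ks_aux e' h)

/-- `X` has a `k`-form compatible with the operators `T g`. -/
def HasForm (k K : Type) [Field k] [Field K] [Algebra k K] {G R : Type} [Ring R] (T : G → R)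
    (X : Type) [AddCommGroup X] [Module K X] [Module R X] : Prop :=
  ∃ (W : Type) (_ : AddCommGroup W) (_ : Module k W) (_ : Module.Finite k W)
    (ρ : G → Module.End k W) (f : X ≃ₗ[K] K ⊗[k] W),
    ∀ g x, f (T g • x) = (ρ g).baseChange K (f x)

/-- `K`-linear maps commuting with generators are `R`-linear. -/
def toRLinear {K G R : Type} [Field K] [Ring R] [Algebra K R] {T : G → R}
    (hT : Algebra.adjoin K (Set.range T) = ⊤)
    {X Y : Type} [AddCommGroup X] [Module K X] [Module R X] [IsScalarTower K R X]
    [AddCommGroup Y] [Module K Y] [Module R Y] [IsScalarTower K R Y]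
    (ψ : X →ₗ[K] Y) (h : ∀ g x, ψ (T g • x) = T g • ψ x) : X →ₗ[R] Y where
  toFun := ψ
  map_add' := map_add ψ
  map_smul' := by
    intro r x
    have hr : r ∈ Algebra.adjoin K (Set.range T) := hT ▸ Algebra.mem_top
    simp only [RingHom.id_apply]
    induction hr using Algebra.adjoin_induction generalizing x with
    | mem r hr => obtain ⟨g, rfl⟩ := hr; exact h g x
    | algebraMap c => rw [algebraMap_smul, algebraMap_smul, map_smul]
    | add a b _ _ ha hb => rw [add_smul, add_smul, map_add, ha, hb]
    | mul a b _ _ ha hb => rw [mul_smul, mul_smul, ha, hb]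

section
variable {k K : Type} [Field k] [Field K] [Algebra k K] {G R : Type} [Ring R] [Algebra K R]
  {T : G → R}
  {X Y : Type} [AddCommGroup X] [Module K X] [Module R X] [IsScalarTower K R X]
  [AddCommGroup Y] [Module K Y] [Module R Y] [IsScalarTower K R Y]

theorem HasForm.congr (h : HasForm k K T X) (e : X ≃ₗ[R] Y) : HasForm k K T Y := by
  obtain ⟨W, _, _, _, ρ, f, hf⟩ := h
  refine ⟨W, _, _, inferInstance, ρ, (e.symm.restrictScalars K).trans f, ?_⟩
  intro g x
  change f (e.symm (T g • x)) = _
  rw [map_smul, hf]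
  rfl

theorem HasForm.prod (h : HasForm k K T X) (h' : HasForm k K T Y) : HasForm k K T (X × Y) := by
  obtain ⟨W, _, _, _, ρ, f, hf⟩ := h
  obtain ⟨W', _, _, _, ρ', f', hf'⟩ := h'
  refine ⟨W × W', inferInstance, inferInstance, inferInstance, fun g => (ρ g).prodMap (ρ' g),
    (f.prodCongr f').trans (TensorProduct.prodRight k K K W W').symm, ?_⟩
  rintro g ⟨x, y⟩
  apply (TensorProduct.prodRight k K K W W').injective
  have key : ∀ t : K ⊗[k] (W × W'), TensorProduct.prodRight k K K W W'
      (((ρ g).prodMap (ρ' g)).baseChange K t) =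
      ((ρ g).baseChange K (TensorProduct.prodRight k K K W W' t).1,
       (ρ' g).baseChange K (TensorProduct.prodRight k K K W W' t).2) := by
    intro t
    induction t using TensorProduct.induction_on with
    | zero => simp only [map_zero, Prod.fst_zero, Prod.snd_zero]; rfl
    | tmul a w => simp
    | add a b ha hb => simp only [map_add, ha, hb, Prod.fst_add, Prod.snd_add, Prod.mk_add_mk]
  rw [key]
  simp [hf, hf']

theorem HasForm.finite (h : HasForm k K T X) : Module.Finite K X := by
  obtain ⟨W, _, _, _, ρ, f, hf⟩ := h
  exact Module.Finite.equiv f.symm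

theorem HasForm.of_subsingleton [Subsingleton X] : HasForm k K T X := by
  refine ⟨PUnit, inferInstance, inferInstance, inferInstance, fun _ => 0, ?_, ?_⟩
  · have : Subsingleton (K ⊗[k] PUnit) :=
      (TensorProduct.comm k K PUnit).injective.subsingleton
    exact { (0 : X →ₗ[K] K ⊗[k] PUnit) with
            invFun := 0
            left_inv := fun _ => Subsingleton.elim _ _
            right_inv := fun _ => Subsingleton.elim _ _ }
  · intro g x
    have : Subsingleton (K ⊗[k] PUnit) :=
      (TensorProduct.comm k K PUnit).injective.subsingleton
    exact Subsingleton.elim _ _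

end

section
variable {k K : Type} [Field k] [Field K] [Algebra k K] {G : Type}
variable {W : Type} [AddCommGroup W] [Module k W] [Module.Finite k W]

/-- endomorphisms of the base change are spanned by base changes of endomorphisms. -/
theorem end_span (ρ : G → Module.End k W) (ψ : Module.End K (K ⊗[k] W))
    (hψ : ∀ g t, ψ ((ρ g).baseChange K t) = (ρ g).baseChange K (ψ t)) :
    ψ ∈ Submodule.span K ((fun φ : Module.End k W => (φ.baseChange K : Module.End K (K ⊗[k] W))) ''
      (Subalgebra.centralizer k (Set.range ρ) : Set (Module.End k W))) := by
  classical
  let c := Module.Basis.ofVectorSpace k K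
  let q := TensorProduct.equivFinsuppOfBasisLeft (N := W) c
  let ψi : Module.Basis.ofVectorSpaceIndex k K → Module.End k W := fun i =>
    Finsupp.lapply i ∘ₗ q.toLinearMap ∘ₗ (ψ.restrictScalars k) ∘ₗ (TensorProduct.mk k K W 1)
  have hψi : ∀ i w, ψi i w = q (ψ (1 ⊗ₜ w)) i := fun i w => rfl
  have hq : ∀ g t i, q ((ρ g).baseChange K t) i = ρ g (q t i) := by
    intro g t i
    induction t using TensorProduct.induction_on with
    | zero => simp
    | tmul a w =>
      simp [q]
    | add a b ha hb => simp only [map_add, Finsupp.add_apply, ha, hb]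
  have hcent : ∀ i, ψi i ∈ Subalgebra.centralizer k (Set.range ρ) := by
    intro i
    rw [Subalgebra.mem_centralizer_iff]
    rintro _ ⟨g, rfl⟩
    ext w
    change ρ g (ψi i w) = ψi i (ρ g w)
    rw [hψi, hψi, ← hq, ← hψ]
    simp
  let b := Module.finBasis k W
  let s : Finset (Module.Basis.ofVectorSpaceIndex k K) :=
    Finset.univ.biUnion fun l => (q (ψ (1 ⊗ₜ b l))).support
  have hsum : ψ = ∑ i ∈ s, c i • ((ψi i).baseChange K : Module.End K (K ⊗[k] W)) := by
    refine (b.baseChange K).ext fun l => ?_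
    rw [Module.Basis.baseChange_apply, LinearMap.sum_apply]
    simp only [LinearMap.smul_apply, LinearMap.baseChange_tmul, hψi]
    conv_lhs => rw [← q.symm_apply_apply (ψ (1 ⊗ₜ b l))]
    rw [TensorProduct.equivFinsuppOfBasisLeft_symm_apply]
    rw [Finsupp.sum_of_support_subset _ (s := s)]
    · simp [TensorProduct.smul_tmul']
    · exact Finset.subset_biUnion_of_mem (fun l => (q (ψ (1 ⊗ₜ b l))).support) (Finset.mem_univ l)
    · simp
  rw [hsum]
  exact Submodule.sum_mem _ fun i _ => Submodule.smul_mem _ _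
    (Submodule.subset_span ⟨_, hcent i, rfl⟩)
end

section
variable {k K : Type} [Field k] [Field K] [Algebra k K] {G R : Type} [Ring R] [Algebra K R]
  {T : G → R}
  {X : Type} [AddCommGroup X] [Module K X] [Module R X] [IsScalarTower K R X]

theorem HasForm.split_or_local (hT : Algebra.adjoin K (Set.range T) = ⊤)
    (hk : ∀ s : Finset k, ∃ k0 : Subring k, Finite k0 ∧ (s : Set k) ⊆ k0)
    (hcl : ∀ x : K, IsIntegral k x → x ∈ (algebraMap k K).range)
    [Nontrivial X] (h : HasForm k K T X) :
    IsLocalRing (Module.End R X) ∨ ∃ X1 X2 : Submodule R X, IsCompl X1 X2 ∧ X1 ≠ ⊥ ∧ X2 ≠ ⊥ ∧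
      HasForm k K T X1 ∧ HasForm k K T X2 := by
  obtain ⟨W, _, _, _, ρ, f, hf⟩ := h
  let E := Subalgebra.centralizer k (Set.range ρ)
  have hcomm : ∀ (φ : E) g w, φ.1 (ρ g w) = ρ g (φ.1 w) := by
    intro φ g w
    have := (Subalgebra.mem_centralizer_iff k).1 φ.2 (ρ g) ⟨g, rfl⟩
    exact (LinearMap.congr_fun this w).symm
  have hcommK : ∀ (φ : E) g t, φ.1.baseChange K ((ρ g).baseChange K t) =
      (ρ g).baseChange K (φ.1.baseChange K t) := by
    intro φ g t
    induction t using TensorProduct.induction_on with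
    | zero => simp
    | tmul a w => simp [hcomm]
    | add a b ha hb => simp only [map_add, ha, hb]
  have hf' : ∀ g t, f.symm ((ρ g).baseChange K t) = T g • f.symm t := by
    intro g t
    apply f.injective
    rw [hf]; simp
  let j0 : E → Module.End R X := fun φ => toRLinear hT
    (f.symm.toLinearMap ∘ₗ φ.1.baseChange K ∘ₗ f.toLinearMap) (by
      intro g x
      simp [hf, hcommK, hf'])
  have hj0 : ∀ φ x, j0 φ x = f.symm (φ.1.baseChange K (f x)) := fun φ x => rfl
  let j : E →+* Module.End R X :=
    { toFun := j0
      map_one' := by ext x; simp [hj0, LinearMap.baseChange_one]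
      map_mul' := by intro a b; ext x; simp [hj0, LinearMap.baseChange_mul]
      map_zero' := by ext x; simp [hj0]
      map_add' := by intro a b; ext x; simp [hj0, LinearMap.baseChange_add] }
  have hj : ∀ φ x, j φ x = f.symm (φ.1.baseChange K (f x)) := fun φ x => rfl
  have : Nontrivial W := by
    by_contra hW
    rw [not_nontrivial_iff_subsingleton] at hW
    have : Subsingleton (K ⊗[k] W) := by
      refine ⟨fun a b => ?_⟩
      have : ∀ t : K ⊗[k] W, t = 0 := by
        intro t
        induction t using TensorProduct.induction_on with
        | zero => rfl
        | tmul a w => rw [Subsingleton.elim w 0, tmul_zero]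
        | add a b ha hb => rw [ha, hb, add_zero]
      rw [this a, this b]
    exact not_subsingleton X f.injective.subsingleton
  by_cases hid : ∀ e : E, IsIdempotentElem e → e = 0 ∨ e = 1
  · left
    refine isLocalRing_of_span (k := k) (K := K) hk hcl hid j ?_ ?_
    · intro c φ
      ext x
      rw [LinearMap.smul_apply, hj, hj, ← map_smul, algebraMap_smul]
      simp [LinearMap.baseChange_smul]
    · rw [eq_top_iff]
      intro ψ _
      have h1 := end_span ρ (f.toLinearMap ∘ₗ (ψ.restrictScalars K) ∘ₗ f.symm.toLinearMap) (by
        intro g t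
        simp [hf', hf])
      let L : Module.End K (K ⊗[k] W) →ₗ[K] Module.End K X :=
        (f.symm.conj).toLinearMap
      have h2 := Submodule.mem_map_of_mem (f := L) h1
      rw [Submodule.map_span] at h2
      let L' : Module.End R X →ₗ[K] Module.End K X := LinearMap.restrictScalarsₗ K R X X K
      have h3 : L' ψ ∈ Submodule.map L' (Submodule.span K (Set.range j)) := by
        rw [Submodule.map_span]
        convert Submodule.span_mono ?_ h2 using 1
        · ext x; simp [L, L', LinearEquiv.conj_apply]
        · rintro _ ⟨_, ⟨φ, hφ, rfl⟩, rfl⟩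
          refine ⟨j ⟨φ, hφ⟩, ⟨_, rfl⟩, ?_⟩
          ext x
          simp [L, L', hj, LinearEquiv.conj_apply]
      obtain ⟨ψ', h4, h5⟩ := h3
      have : ψ' = ψ := by
        ext x
        exact LinearMap.congr_fun h5 x
      exact this ▸ h4
  · right
    push Not at hid
    obtain ⟨e, he, he0, he1⟩ := hid
    have key : ∀ e : E, IsIdempotentElem e → e ≠ 0 →
        HasForm k K T (LinearMap.range (j e)) ∧ LinearMap.range (j e) ≠ ⊥ := by
      intro e he he0
      have hee : ∀ w, e.1 (e.1 w) = e.1 w := fun w =>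
        LinearMap.congr_fun (congrArg Subtype.val he) w
      have hjee : ∀ x, j e (j e x) = j e x := fun x =>
        LinearMap.congr_fun ((map_mul j e e).symm.trans (congrArg j he)) x
      let W1 := LinearMap.range e.1
      let π := LinearMap.rangeRestrict e.1
      have hsub : ∀ t, (W1.subtype.baseChange K) (π.baseChange K t) = e.1.baseChange K t := by
        intro t
        rw [← LinearMap.comp_apply, ← LinearMap.baseChange_comp]
        rfl
      have hπs : ∀ t, π.baseChange K (W1.subtype.baseChange K t) = t := by
        intro t
        rw [← LinearMap.comp_apply, ← LinearMap.baseChange_comp]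
        have : π ∘ₗ W1.subtype = LinearMap.id := by
          ext ⟨_, w, rfl⟩
          exact hee w
        rw [this]; simp
      constructor
      · have hρ1 : ∀ g, ∀ w ∈ W1, ρ g w ∈ W1 := by
          rintro g _ ⟨w, rfl⟩
          exact ⟨ρ g w, hcomm e g w⟩
        let ρ1 : G → Module.End k W1 := fun g => (ρ g).restrict (hρ1 g)
        have hπρ : ∀ g t, π.baseChange K ((ρ g).baseChange K t) =
            (ρ1 g).baseChange K (π.baseChange K t) := by
          intro g t
          rw [← LinearMap.comp_apply, ← LinearMap.comp_apply, ← LinearMap.baseChange_comp,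
            ← LinearMap.baseChange_comp]
          congr 2
          ext w
          exact hcomm e g w
        let p : LinearMap.range (j e) →ₗ[K] K ⊗[k] W1 :=
          π.baseChange K ∘ₗ f.toLinearMap ∘ₗ ((LinearMap.range (j e)).subtype.restrictScalars K)
        have hp : ∀ x, p x = π.baseChange K (f x.1) := fun x => rfl
        have hfix : ∀ x : LinearMap.range (j e), j e x.1 = x.1 := by
          rintro ⟨_, x, rfl⟩
          exact hjee x
        refine ⟨W1, inferInstance, inferInstance, inferInstance, ρ1,
          LinearEquiv.ofBijective p ⟨?_, ?_⟩, ?_⟩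
        · rw [← LinearMap.ker_eq_bot, LinearMap.ker_eq_bot']
          intro x hx
          apply Subtype.ext
          rw [← hfix x, hj, ← hsub]
          rw [hp] at hx
          rw [hx]; simp
        · intro t
          refine ⟨⟨f.symm (W1.subtype.baseChange K t), f.symm (W1.subtype.baseChange K t), ?_⟩, ?_⟩
          · rw [hj, LinearEquiv.apply_symm_apply, ← hsub, hπs]
          · rw [hp]
            change π.baseChange K (f (f.symm (W1.subtype.baseChange K t))) = t
            rw [LinearEquiv.apply_symm_apply]
            exact hπs t
        · intro g x
          change p (T g • x) = (ρ1 g).baseChange K (p x)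
          rw [hp, hp, ← hπρ, ← hf]
          rfl
      · intro hbot
        apply he0
        apply Subtype.ext
        ext w
        by_contra hw
        have h1 : j e (f.symm (1 ⊗ₜ w)) = 0 := by
          have : j e (f.symm (1 ⊗ₜ w)) ∈ LinearMap.range (j e) := ⟨_, rfl⟩
          rw [hbot] at this
          simpa using this
        rw [hj] at h1
        simp only [LinearEquiv.apply_symm_apply, LinearMap.baseChange_tmul,
          EmbeddingLike.map_eq_zero_iff] at h1
        have h2 : e.1 w = 0 := by
          have := Module.FaithfullyFlat.tensorProduct_mk_injective (A := k) (B := K) W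
          apply this
          simpa using h1
        exact hw h2
    have hec : IsIdempotentElem (1 - e) := he.one_sub
    obtain ⟨h1, h1'⟩ := key e he he0
    obtain ⟨h2, h2'⟩ := key (1 - e) hec (by rw [sub_ne_zero]; exact he1.symm)
    refine ⟨_, _, ?_, h1', h2', h1, h2⟩
    have hje : IsIdempotentElem (j e) := he.map j
    have hadd : ∀ x, j e x + j (1 - e) x = x := by
      intro x
      rw [← LinearMap.add_apply, ← map_add]; simp
    have hjj : ∀ x, j e (j (1 - e) x) = 0 := by
      intro x
      have : j e * j (1 - e) = 0 := by rw [← map_mul, mul_sub, he.eq]; simp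
      exact LinearMap.congr_fun this x
    constructor
    · rw [Submodule.disjoint_def]
      rintro _ ⟨x, rfl⟩ ⟨y, hy⟩
      have h3 : j e (j e x) = j e x := LinearMap.congr_fun hje.eq x
      rw [← h3, ← hy, hjj]
    · rw [codisjoint_iff, eq_top_iff]
      intro x _
      rw [← hadd x]
      exact Submodule.add_mem_sup ⟨x, rfl⟩ ⟨x, rfl⟩

end

theorem HasForm.exists_local {k K : Type} [Field k] [Field K] [Algebra k K] {G R : Type} [Ring R]
    [Algebra K R] {T : G → R} (hT : Algebra.adjoin K (Set.range T) = ⊤)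
    (hk : ∀ s : Finset k, ∃ k0 : Subring k, Finite k0 ∧ (s : Set k) ⊆ k0)
    (hcl : ∀ x : K, IsIntegral k x → x ∈ (algebraMap k K).range) (n : ℕ) :
    ∀ (X : Type) [AddCommGroup X] [Module K X] [Module R X] [IsScalarTower K R X] [Nontrivial X],
      Module.finrank K X = n → HasForm k K T X →
      ∃ (X1 X2 : Type) (_ : AddCommGroup X1) (_ : Module K X1) (_ : Module R X1)
        (_ : IsScalarTower K R X1) (_ : AddCommGroup X2) (_ : Module K X2) (_ : Module R X2)
        (_ : IsScalarTower K R X2), IsLocalRing (Module.End R X1) ∧ HasForm k K T X1 ∧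
        HasForm k K T X2 ∧ Nonempty (X ≃ₗ[R] X1 × X2) := by
  induction n using Nat.strong_induction_on with
  | _ n ih =>
    intro X _ _ _ _ _ hn h
    rcases h.split_or_local hT hk hcl with hl | ⟨X1, X2, hc, h1, h2, hf1, hf2⟩
    · exact ⟨X, (⊥ : Submodule R X), inferInstance, inferInstance, inferInstance, inferInstance,
        inferInstance, inferInstance, inferInstance, inferInstance, hl, h,
        HasForm.of_subsingleton, ⟨(LinearEquiv.prodUnique (R := R)).symm⟩⟩
    · have := hf1.finite
      have := hf2.finite
      have hn1 : Nontrivial X1 := Submodule.nontrivial_iff_ne_bot.2 h1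
      have hn2 : Nontrivial X2 := Submodule.nontrivial_iff_ne_bot.2 h2
      let e := Submodule.prodEquivOfIsCompl X1 X2 hc
      have hrank : Module.finrank K X1 + Module.finrank K X2 = n := by
        rw [← hn, ← (e.restrictScalars K).finrank_eq, Module.finrank_prod]
      have hpos : 0 < Module.finrank K X2 := Module.finrank_pos
      obtain ⟨A, B, _, _, _, _, _, _, _, _, hl, hA, hB, ⟨e'⟩⟩ :=
        ih (Module.finrank K X1) (by omega) X1 rfl hf1
      exact ⟨A, B × X2, inferInstance, inferInstance, inferInstance, inferInstance,
        inferInstance, inferInstance, inferInstance, inferInstance, hl, hA, hB.prod hf2,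
        ⟨e.symm.trans ((e'.prodCongr (LinearEquiv.refl R X2)).trans
          (LinearEquiv.prodAssoc R A B X2))⟩⟩

theorem HasForm.summand {k K : Type} [Field k] [Field K] [Algebra k K] {G R : Type} [Ring R]
    [Algebra K R] {T : G → R} (hT : Algebra.adjoin K (Set.range T) = ⊤)
    (hk : ∀ s : Finset k, ∃ k0 : Subring k, Finite k0 ∧ (s : Set k) ⊆ k0)
    (hcl : ∀ x : K, IsIntegral k x → x ∈ (algebraMap k K).range) (n : ℕ) :
    ∀ (X U U' : Type) [AddCommGroup X] [Module K X] [Module R X] [IsScalarTower K R X]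
      [AddCommGroup U] [Module K U] [Module R U] [IsScalarTower K R U]
      [AddCommGroup U'] [Module K U'] [Module R U'] [IsScalarTower K R U'],
      Module.finrank K X = n → HasForm k K T X → (X ≃ₗ[R] U × U') → HasForm k K T U := by
  induction n using Nat.strong_induction_on with
  | _ n ih =>
    intro X U U' _ _ _ _ _ _ _ _ _ _ _ _ hn h e
    rcases subsingleton_or_nontrivial X with hs | hs
    · have : Subsingleton (U × U') := e.symm.injective.subsingleton
      have : Subsingleton U := (LinearMap.inl_injective (R := R) (M := U) (M₂ := U')).subsingleton
      exact HasForm.of_subsingleton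
    · obtain ⟨A, B, _, _, _, _, _, _, _, _, hl, hA, hB, ⟨e'⟩⟩ :=
        HasForm.exists_local hT hk hcl n X hn h
      have := hA.finite
      have := hB.finite
      have hrank : Module.finrank K A + Module.finrank K B = n := by
        rw [← hn, (e'.restrictScalars K).finrank_eq, Module.finrank_prod]
      have hnA : Nontrivial A := by
        by_contra hc
        rw [not_nontrivial_iff_subsingleton] at hc
        exact zero_ne_one (α := Module.End R A) (Subsingleton.elim _ _)
      have hpos : 0 < Module.finrank K A := Module.finrank_pos
      rcases ks_step (e'.symm.trans e) with ⟨U1, ⟨e1⟩, ⟨e2⟩⟩ | ⟨U1, ⟨e1⟩, ⟨e2⟩⟩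
      · have := ih (Module.finrank K B) (by omega) B U1 U' rfl hB e2
        exact (hA.prod this).congr e1.symm
      · exact ih (Module.finrank K B) (by omega) B U U1 rfl hB
          (e2.trans (LinearEquiv.prodComm R U1 U))

/-- operator version of `HasForm` -/
def OpForm (k K : Type) [Field k] [Field K] [Algebra k K] {G : Type}
    {X : Type} [AddCommGroup X] [Module K X] (T : G → Module.End K X) : Prop :=
  ∃ (W : Type) (_ : AddCommGroup W) (_ : Module k W) (_ : Module.Finite k W)
    (ρ : G → Module.End k W) (f : X ≃ₗ[K] K ⊗[k] W),
    ∀ g x, f (T g x) = (ρ g).baseChange K (f x)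

theorem OpForm.retract {k K : Type} [Field k] [Field K] [Algebra k K]
    (hk : ∀ s : Finset k, ∃ k0 : Subring k, Finite k0 ∧ (s : Set k) ⊆ k0)
    (hcl : ∀ x : K, IsIntegral k x → x ∈ (algebraMap k K).range) {G : Type}
    {X M : Type} [AddCommGroup X] [Module K X] [AddCommGroup M] [Module K M]
    {T : G → Module.End K X} {S : G → Module.End K M} (h : OpForm k K T)
    (i : M →ₗ[K] X) (r : X →ₗ[K] M) (hi : ∀ g m, i (S g m) = T g (i m))
    (hr : ∀ g x, r (T g x) = S g (r x)) (hri : ∀ m, r (i m) = m) : OpForm k K S := by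
  let R := Algebra.adjoin K (Set.range T)
  let T' : G → R := fun g => ⟨T g, Algebra.subset_adjoin ⟨g, rfl⟩⟩
  have hT' : Algebra.adjoin K (Set.range T') = ⊤ := by
    have h1 : Set.range T = R.val '' (Set.range T') := by
      rw [← Set.range_comp]; rfl
    apply Subalgebra.map_injective (f := R.val) Subtype.val_injective
    rw [AlgHom.map_adjoin, ← h1, Algebra.map_top, Subalgebra.range_val]
  have hX : HasForm k K T' X := h
  let e : X →ₗ[K] X := i ∘ₗ r
  let eR : X →ₗ[R] X := toRLinear hT' e (by
    intro g x
    change i (r (T g x)) = T g (i (r x))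
    rw [hr, hi])
  have he : ∀ x, eR x = i (r x) := fun x => rfl
  have hee : eR ∘ₗ eR = eR := by
    ext x
    simp only [LinearMap.comp_apply, he, hri]
  have hc : IsCompl (LinearMap.range eR) (LinearMap.ker eR) :=
    LinearMap.IsIdempotentElem.isCompl hee
  have hU := HasForm.summand hT' hk hcl _ X (LinearMap.range eR) (LinearMap.ker eR) rfl hX
    (Submodule.prodEquivOfIsCompl _ _ hc).symm
  obtain ⟨W, _, _, _, ρ, f, hf⟩ := hU
  let q : M →ₗ[K] LinearMap.range eR :=
    LinearMap.codRestrict ((LinearMap.range eR).restrictScalars K) i (by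
      intro m
      exact ⟨i m, by rw [he, hri]⟩)
  have hq : ∀ m, (q m : X) = i m := fun m => rfl
  have hqb : Function.Bijective q := by
    constructor
    · intro a b hab
      have := congrArg (fun t : LinearMap.range eR => r (t : X)) hab
      simpa [hq, hri] using this
    · rintro ⟨_, x, rfl⟩
      exact ⟨r x, Subtype.ext rfl⟩
  refine ⟨W, _, _, inferInstance, ρ, (LinearEquiv.ofBijective q hqb).trans f, ?_⟩
  intro g m
  change f (q (S g m)) = (ρ g).baseChange K (f (q m))
  rw [← hf]
  congr 1
  apply Subtype.ext
  exact hi g m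

open Polynomial in
theorem jordan_quot (K : Type) [Field K] (e : ℕ) :
    ∃ (b : Module.Basis (Fin e) K (K[X] ⧸ (Submodule.span K[X] {(X : K[X]) ^ e}))),
      ∀ j, (X : K[X]) • b j = 0 ∨ ∃ j', (X : K[X]) • b j = b j' := by
  have hm : ((X : K[X]) ^ e).Monic := monic_X_pow e
  let pb := AdjoinRoot.powerBasis' hm
  have hd : pb.dim = e := by simp [pb]
  let b0 : Module.Basis (Fin e) K (AdjoinRoot ((X : K[X]) ^ e)) := pb.basis.reindex (finCongr hd)
  have hb0 : ∀ j, b0 j = AdjoinRoot.root ((X : K[X]) ^ e) ^ (j : ℕ) := by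
    intro j; simp [b0, pb]
  have hX : ∀ y : AdjoinRoot ((X : K[X]) ^ e), ((X : K[X]) •
      (show K[X] ⧸ (Submodule.span K[X] {(X : K[X]) ^ e}) from y)) =
      (AdjoinRoot.root ((X : K[X]) ^ e) * y : AdjoinRoot ((X : K[X]) ^ e)) := by
    intro y
    obtain ⟨q, rfl⟩ := AdjoinRoot.mk_surjective y
    rfl
  refine ⟨b0, fun j => ?_⟩
  have key : (X : K[X]) • (show K[X] ⧸ (Submodule.span K[X] {(X : K[X]) ^ e}) from b0 j) =
      AdjoinRoot.root ((X : K[X]) ^ e) ^ ((j : ℕ) + 1) := by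
    rw [hX, hb0, ← pow_succ']
  by_cases h : (j : ℕ) + 1 < e
  · right
    exact ⟨⟨j + 1, h⟩, key.trans (hb0 ⟨j + 1, h⟩).symm⟩
  · left
    have : (j : ℕ) + 1 = e := by have := j.2; omega
    rw [this] at key
    refine key.trans ?_
    have h0 : AdjoinRoot.root ((X : K[X]) ^ e) ^ e = 0 := by
      simpa using AdjoinRoot.eval₂_root ((X : K[X]) ^ e)
    exact h0

open Polynomial in
theorem jordan_basis {K M : Type} [Field K] [AddCommGroup M] [Module K M] [Module.Finite K M]
    (N : Module.End K M) (hN : IsNilpotent N) :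
    ∃ (ι : Type) (_ : Fintype ι) (b : Module.Basis ι K M),
      ∀ j, N (b j) = 0 ∨ ∃ j', N (b j) = b j' := by
  classical
  obtain ⟨n, hn⟩ := hN
  let A := Module.AEval' N
  have hX : ∀ m : M, (X : K[X]) • (Module.AEval'.of N m) = Module.AEval'.of N (N m) :=
    fun m => Module.AEval'.X_smul_of N m
  have htor : Module.IsTorsion' A (Submonoid.powers (X : K[X])) := by
    intro x
    refine ⟨⟨X ^ n, n, rfl⟩, ?_⟩
    obtain ⟨m, rfl⟩ := (Module.AEval'.of N).surjective x
    change (X ^ n : K[X]) • (Module.AEval'.of N m) = 0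
    have := Module.AEval'.X_pow_smul_of N m n
    rw [this, hn]; simp
  obtain ⟨d, e, ⟨f⟩⟩ := Module.torsion_by_prime_power_decomposition
    (R := K[X]) (M := A) (p := X) irreducible_X htor
  choose bq hbq using fun i => jordan_quot K (e i)
  let bb := DFinsupp.basis bq
  let f' := f.restrictScalars K
  let b : Module.Basis _ K M := bb.map (f'.symm.trans (Module.AEval'.of N).symm)
  refine ⟨_, inferInstance, b, ?_⟩
  have hb : ∀ j, f (Module.AEval'.of N (b j)) = bb j := by
    intro j
    simp [b, f']
  have hbb : ∀ j, bb j = DFinsupp.single j.1 (bq j.1 j.2) := by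
    intro j
    apply bb.repr.injective
    rw [Module.Basis.repr_self]
    change _ = sigmaFinsuppEquivDFinsupp.symm (DFinsupp.mapRange.linearEquiv
      (fun i => (bq i).repr) (DFinsupp.single j.1 (bq j.1 j.2)))
    rw [Equiv.eq_symm_apply, sigmaFinsuppEquivDFinsupp_single]
    rw [DFinsupp.mapRange.linearEquiv_apply, DFinsupp.mapRange_single]
    simp
  intro j
  have hinj : ∀ m m' : M, f (Module.AEval'.of N m) = f (Module.AEval'.of N m') → m = m' := 
    fun m m' h => (Module.AEval'.of N).injective (f.injective h)
  have h1 : f (Module.AEval'.of N (N (b j))) =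
      DirectSum.lof K[X] _ _ j.1 ((X : K[X]) • (bq j.1 j.2)) := by
    rw [← hX, map_smul, hb, hbb, map_smul]; rfl
  rcases hbq j.1 j.2 with h | ⟨j', h⟩
  · left
    apply hinj
    rw [h1, h]; simp
  · right
    refine ⟨⟨j.1, j'⟩, ?_⟩
    apply hinj
    rw [h1, h, hb, hbb]
    rfl

/-- the operator `T` has entries in `k` with respect to the basis `b` -/
def RatOp (k : Type) {K X ι : Type} [Field k] [Field K] [Algebra k K] [AddCommGroup X]
    [Module K X] (b : Module.Basis ι K X) (T : Module.End K X) : Prop :=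
  ∀ i j, b.repr (T (b j)) i ∈ (algebraMap k K).range

section
variable {k K X ι : Type} [Field k] [Field K] [Algebra k K] [AddCommGroup X] [Module K X]

theorem RatOp.mem_iff [Fintype ι] [DecidableEq ι] (b : Module.Basis ι K X) (T : Module.End K X) :
    RatOp k b T ↔
      LinearMap.toMatrixAlgEquiv b T ∈ (Subring.matrix (n := ι) (algebraMap k K).range) := by
  have h : ∀ i j, LinearMap.toMatrixAlgEquiv b T i j = b.repr (T (b j)) i := fun i j =>
    LinearMap.toMatrixAlgEquiv_apply b T i j
  constructor
  · intro H i j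
    rw [h]; exact H i j
  · intro H i j
    rw [← h]; exact H i j

theorem RatOp.pow [Fintype ι] {b : Module.Basis ι K X} {T : Module.End K X}
    (h : RatOp k b T) (m : ℕ) : RatOp k b (T ^ m) := by
  classical
  rw [RatOp.mem_iff] at *
  rw [map_pow]
  exact Subring.pow_mem _ h m

theorem RatOp.one_add [Fintype ι] {b : Module.Basis ι K X} {T : Module.End K X}
    (h : RatOp k b T) : RatOp k b (1 + T) := by
  classical
  rw [RatOp.mem_iff] at *
  rw [map_add, map_one]
  exact Subring.add_mem _ (Subring.one_mem _) h

theorem OpForm.of_basis {G : Type} {T : G → Module.End K X} [Finite ι] (b : Module.Basis ι K X)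
    (h : ∀ g, RatOp k b (T g)) : OpForm k K T := by
  classical
  have := Fintype.ofFinite ι
  choose A hA using h
  let ρ : G → Module.End k (ι → k) := fun g => Matrix.toLin' (Matrix.of fun i j => A g i j)
  let b' : Module.Basis ι K (K ⊗[k] (ι → k)) := (Pi.basisFun k ι).baseChange K
  let f : X ≃ₗ[K] K ⊗[k] (ι → k) := b.equiv b' (Equiv.refl _)
  refine ⟨ι → k, inferInstance, inferInstance, inferInstance, ρ, f, ?_⟩
  intro g x
  have : f.toLinearMap ∘ₗ T g = (ρ g).baseChange K ∘ₗ f.toLinearMap := by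
    apply b.ext
    intro j
    have h1 : T g (b j) = ∑ i, algebraMap k K (A g i j) • b i := by
      conv_lhs => rw [← b.sum_repr (T g (b j))]
      simp only [hA]
    have h2 : ∀ j, f (b j) = (1 : K) ⊗ₜ[k] (Pi.single j (1 : k)) := by
      intro j; simp [f, b']
    have h3 : ρ g (Pi.single j 1) = ∑ i, A g i j • Pi.single i (1 : k) := by
      ext i
      simp [ρ, Finset.sum_apply, Pi.single_apply]
    simp only [LinearMap.comp_apply, LinearEquiv.coe_coe, h1, map_sum, map_smul, h2,
      LinearMap.baseChange_tmul, h3, tmul_sum, tmul_smul, algebraMap_smul]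
  exact LinearMap.congr_fun this x

theorem OpForm.exists_basis {G : Type} {T : G → Module.End K X} (h : OpForm k K T) :
    ∃ (ι : Type) (_ : Fintype ι) (b : Module.Basis ι K X), ∀ g, RatOp k b (T g) := by
  obtain ⟨W, _, _, _, ρ, f, hf⟩ := h
  let b0 := Module.finBasis k W
  let b' := b0.baseChange K
  refine ⟨_, inferInstance, b'.map f.symm, ?_⟩
  intro g i j
  refine ⟨b0.repr (ρ g (b0 j)) i, ?_⟩
  simp [hf, b', LinearMap.baseChange_tmul, Algebra.smul_def]

theorem unipotent_basis {p : ℕ} [Fact p.Prime] [CharP K p] [Module.Finite K X] (s : Module.End K X)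
    (n : ℕ) (hs : s ^ (p ^ n) = 1) :
    ∃ (ι : Type) (_ : Fintype ι) (b : Module.Basis ι K X), ∀ m, RatOp k b (s ^ m) := by
  have hnil : IsNilpotent (s - 1) := by
    refine ⟨p ^ n, ?_⟩
    by_cases hX : Subsingleton X
    · have : Subsingleton (Module.End K X) := inferInstance
      exact Subsingleton.elim _ _
    rw [not_subsingleton_iff_nontrivial] at hX
    have : CharP (Module.End K X) p := charP_of_injective_algebraMap (algebraMap K _).injective p
    rw [sub_pow_char_pow_of_commute _ _ (Commute.one_right s), hs, one_pow, sub_self]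
  obtain ⟨ι, _, b, hb⟩ := jordan_basis _ hnil
  refine ⟨ι, inferInstance, b, fun m => RatOp.pow ?_ m⟩
  have : RatOp k b (s - 1) := by
    classical
    intro i j
    rcases hb j with h | ⟨j', h⟩
    · rw [h]; simp
    · rw [h, Module.Basis.repr_self, Finsupp.single_apply]
      split_ifs
      · exact Subring.one_mem _
      · exact Subring.zero_mem _
  simpa using this.one_add

end

theorem OpForm.of_sylow {k K : Type} [Field k] [Field K] [Algebra k K]
    (hk : ∀ s : Finset k, ∃ k0 : Subring k, Finite k0 ∧ (s : Set k) ⊆ k0)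
    (hcl : ∀ x : K, IsIntegral k x → x ∈ (algebraMap k K).range)
    {p : ℕ} [Fact p.Prime] [CharP K p] {G : Type} [Group G] [Finite G]
    (hG : ∀ P : Sylow p G, IsCyclic P)
    {M : Type} [AddCommGroup M] [Module K M] [Module.Finite K M]
    (S : G →* Module.End K M) : OpForm k K (fun g => S g) := by
  classical
  let P : Sylow p G := default
  have hP := hG P
  obtain ⟨σ, hσ⟩ := hP.exists_generator
  obtain ⟨n, hn⟩ := IsPGroup.iff_card.mp P.2
  have hσn : S σ ^ (p ^ n) = 1 := by
    have : σ ^ (p ^ n) = 1 := by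
      have h0 := pow_card_eq_one' (x := σ)
      rwa [hn] at h0
    rw [← map_pow, ← Subgroup.coe_pow, this]; simp
  obtain ⟨ι, _, b, hb⟩ := unipotent_basis (k := k) (S σ) n hσn
  have hbP : ∀ h ∈ (P : Subgroup G), RatOp k b (S h) := by
    intro h hh
    obtain ⟨m, hm⟩ := (isOfFinOrder_of_finite σ).mem_powers_iff_mem_zpowers.mpr (hσ ⟨h, hh⟩)
    have : h = (σ : G) ^ m := by
      have := congrArg Subtype.val hm
      simpa using this.symm
    rw [this, map_pow]
    exact hb m
  let Q := G ⧸ (P : Subgroup G)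
  have : Fintype Q := Fintype.ofFinite Q
  let t : Q → G := Quotient.out
  have ht : ∀ c : Q, ((t c : G) : Q) = c := fun c => Quotient.out_eq' c
  have hmem : ∀ (x : G) (c : Q), (t c)⁻¹ * x * t (x⁻¹ • c) ∈ (P : Subgroup G) := by
    intro x c
    have : ((t c : G) : Q) = ((x * t (x⁻¹ • c) : G) : Q) := by
      rw [ht]
      have h1 : ((x * t (x⁻¹ • c) : G) : Q) = x • ((t (x⁻¹ • c) : G) : Q) := rfl
      rw [h1, ht, smul_inv_smul]
    rw [QuotientGroup.eq] at this
    rwa [mul_assoc]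
  let T : G → Module.End K (Q → M) := fun x =>
    LinearMap.pi fun c => S ((t c)⁻¹ * x * t (x⁻¹ • c)) ∘ₗ LinearMap.proj (x⁻¹ • c)
  have hT : ∀ x f c, T x f c = S ((t c)⁻¹ * x * t (x⁻¹ • c)) (f (x⁻¹ • c)) := fun _ _ _ => rfl
  have hTf : OpForm k K T := by
    refine OpForm.of_basis (Pi.basis fun _ : Q => b) ?_
    rintro x ⟨c, i⟩ ⟨d, j⟩
    rw [Pi.basis_repr, hT, Pi.basis_apply]
    by_cases h : x⁻¹ • c = d
    · subst h
      rw [Pi.single_eq_same]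
      exact hbP _ (hmem x c) i j
    · rw [Pi.single_eq_of_ne h]
      simp
  have hidx : (Nat.card Q : K) ≠ 0 := by
    rw [Ne, CharP.cast_eq_zero_iff K p]
    exact P.not_dvd_index
  have hSS : ∀ a b m, S a (S b m) = S (a * b) m := by
    intro a b m; rw [map_mul]; rfl
  let i : M →ₗ[K] (Q → M) := LinearMap.pi fun c => S (t c)⁻¹
  let r : (Q → M) →ₗ[K] M := (Nat.card Q : K)⁻¹ • ∑ c : Q, S (t c) ∘ₗ LinearMap.proj c
  have hi : ∀ m c, i m c = S (t c)⁻¹ m := fun _ _ => rfl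
  have hr : ∀ f, r f = (Nat.card Q : K)⁻¹ • ∑ c : Q, S (t c) (f c) := by
    intro f; simp [r]
  refine OpForm.retract hk hcl hTf i r ?_ ?_ ?_
  · intro g m
    ext c
    rw [hT, hi, hi, hSS, hSS]
    congr 2
    group
  · intro x f
    rw [hr, hr, map_smul, map_sum]
    congr 1
    rw [← Equiv.sum_comp (MulAction.toPerm x : Equiv.Perm Q)]
    refine Finset.sum_congr rfl fun c _ => ?_
    rw [MulAction.toPerm_apply, hT, inv_smul_smul, hSS, hSS]
    congr 2
    group
  · intro m
    rw [hr]
    simp only [hi, hSS, mul_inv_cancel, map_one, Module.End.one_apply, Finset.sum_const,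
      Finset.card_univ]
    rw [← Nat.card_eq_fintype_card, ← Nat.cast_smul_eq_nsmul K, inv_smul_smul₀ hidx]

theorem finite_subring_of_algebraic {p : ℕ} [Fact p.Prime] {k : Type} [Field k]
    [Algebra (ZMod p) k] (hk : Algebra.IsAlgebraic (ZMod p) k) (s : Finset k) :
    ∃ k0 : Subring k, Finite k0 ∧ (s : Set k) ⊆ k0 := by
  let E := IntermediateField.adjoin (ZMod p) (s : Set k)
  have : FiniteDimensional (ZMod p) E :=
    IntermediateField.finiteDimensional_adjoin fun x _ => (hk.isAlgebraic x).isIntegral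
  have : Finite E := Module.finite_of_finite (ZMod p)
  exact ⟨E.toSubring, this, IntermediateField.subset_adjoin _ _⟩

theorem isBaseChange_span {L K M ι : Type} [Field L] [Field K] [Algebra L K] [AddCommGroup M]
    [Module L M] [Module K M] [IsScalarTower L K M] (b : Module.Basis ι K M) :
    IsBaseChange K (Submodule.span L (Set.range b)).subtype := by
  have hli : LinearIndependent L b := b.linearIndependent.restrict_scalars' L
  let b0 : Module.Basis ι L (Submodule.span L (Set.range b)) := Module.Basis.span hli
  have hb0 : ∀ i, ((b0 i : Submodule.span L (Set.range b)) : M) = b i := fun i =>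
    congrArg Subtype.val (Module.Basis.span_apply hli i)
  let e := (b0.baseChange K).equiv b (Equiv.refl _)
  refine IsBaseChange.of_equiv e fun x => ?_
  have : (e.toLinearMap.restrictScalars L) ∘ₗ (TensorProduct.mk L K _ 1) =
      (Submodule.span L (Set.range b)).subtype := by
    apply b0.ext
    intro i
    have h1 : (1 : K) ⊗ₜ[L] b0 i = b0.baseChange K i := by simp
    change e ((1 : K) ⊗ₜ[L] b0 i) = (b0 i : M)
    rw [h1, hb0]
    exact Module.Basis.equiv_apply _ _ _ _
  exact LinearMap.congr_fun this x

/-- **from Theorem 1.4.** Let `F` be a (C₁-)field of characteristic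
`p > 0` and `G` a finite group whose `p`-Sylow subgroups are cyclic.  Then for every
field extension `K/F`, every finitely generated `KG`-module `M` descends to an
intermediate field `F ⊆ K₀ ⊆ K` that is algebraic over `F`; i.e.
`ed(Mod_{FG}) = 0`. -/
theorem ed_zero_of_cyclic_sylow
    (p : ℕ) [Fact p.Prime] (F : Type) [Field F] [CharP F p] (hC1 : IsC1Field F)
    (G : Type) [Group G] [Fintype G] (hG : ∀ P : Sylow p G, IsCyclic P)
    (K : Type) [Field K] [Algebra F K]
    (M : Type) [AddCommGroup M] [Module F M] [Module K M]
    [Module (MonoidAlgebra F G) M]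
    [IsScalarTower F K M] [IsScalarTower F (MonoidAlgebra F G) M]
    [SMulCommClass K (MonoidAlgebra F G) M]
    [Module.Finite K M] :
    ∃ K₀ : IntermediateField F K, Algebra.IsAlgebraic F K₀ ∧
      DescendsTo F K (MonoidAlgebra F G) M K₀ := by
  have hcp : CharP K p := charP_of_injective_algebraMap (algebraMap F K).injective p
  let _ : Algebra (ZMod p) K := ZMod.algebra K p
  let _ : Algebra (ZMod p) F := ZMod.algebra F p
  have hst : IsScalarTower (ZMod p) F K := IsScalarTower.of_algebraMap_eq' (Subsingleton.elim _ _)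
  let k := algebraicClosure (ZMod p) K
  have hkalg : Algebra.IsAlgebraic (ZMod p) k := inferInstance
  have hk := finite_subring_of_algebraic (p := p) hkalg
  have hcl : ∀ x : K, IsIntegral k x → x ∈ (algebraMap k K).range := by
    intro x hx
    have h1 : IsIntegral (ZMod p) x := isIntegral_trans x hx
    have h2 : x ∈ k := mem_algebraicClosure_iff.mpr h1.isAlgebraic
    exact ⟨⟨x, h2⟩, rfl⟩
  let S : G →* Module.End K M :=
    { toFun := fun g =>
        { toFun := fun m => MonoidAlgebra.of F G g • m
          map_add' := fun a b => smul_add _ a b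
          map_smul' := fun c m => (smul_comm c _ m).symm }
      map_one' := by ext m; simp [← MonoidAlgebra.one_def]
      map_mul' := fun a b => by ext m; simp [← mul_smul] }
  have hS : ∀ g m, S g m = MonoidAlgebra.of F G g • m := fun _ _ => rfl
  obtain ⟨ι, _, b, hb⟩ := (OpForm.of_sylow hk hcl hG S).exists_basis
  refine ⟨algebraicClosure F K, inferInstance,
    Submodule.span (algebraicClosure F K) (Set.range b), ?_, isBaseChange_span b⟩
  have hbas : ∀ g j, MonoidAlgebra.of F G g • b j ∈
      Submodule.span (algebraicClosure F K) (Set.range b) := by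
    intro g j
    rw [← hS, ← b.sum_repr (S g (b j))]
    refine Submodule.sum_mem _ fun i _ => ?_
    obtain ⟨c, hc⟩ := hb g i j
    have hcL : (c : K) ∈ algebraicClosure F K :=
      mem_algebraicClosure_iff.mpr
        ((mem_algebraicClosure_iff.mp c.2).extendScalars (algebraMap (ZMod p) F).injective)
    have h1 : b.repr (S g (b j)) i = (⟨(c : K), hcL⟩ : algebraicClosure F K) := hc.symm
    rw [h1]
    exact Submodule.smul_mem _ (⟨(c : K), hcL⟩ : algebraicClosure F K)
      (Submodule.subset_span ⟨i, rfl⟩)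
  have hg : ∀ g x, x ∈ Submodule.span (algebraicClosure F K) (Set.range b) →
      MonoidAlgebra.of F G g • x ∈ Submodule.span (algebraicClosure F K) (Set.range b) := by
    intro g x hx
    induction hx using Submodule.span_induction with
    | mem x hx => obtain ⟨j, rfl⟩ := hx; exact hbas g j
    | zero => rw [smul_zero]; exact Submodule.zero_mem _
    | add x y _ _ h1 h2 => rw [smul_add]; exact Submodule.add_mem _ h1 h2
    | smul c x _ h =>
      have : MonoidAlgebra.of F G g • c • x = c • MonoidAlgebra.of F G g • x :=
        (smul_comm (c : K) (MonoidAlgebra.of F G g) x).symm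
      rw [this]
      exact Submodule.smul_mem _ _ h
  intro a x hx
  induction a using MonoidAlgebra.induction_on with
  | of g => exact hg g x hx
  | add a b h1 h2 => rw [add_smul]; exact Submodule.add_mem _ h1 h2
  | smul c a h =>
    rw [smul_assoc, ← IsScalarTower.algebraMap_smul K c (a • x)]
    exact Submodule.smul_mem _ (algebraMap F (algebraicClosure F K) c) h
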